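/- Let K be a field of characteristic p > 0 with a normalized discrete valuation v. Let f ∈ K with v(f) < 0 and p ∤ v(f), and let L = K_{℘,f} be the splitting field of T^p − T − f over K. Then there is a unique extension v_L of v to L, and it satisfies e(v_L|v) = p and f(v_L|v) = 1; in particular L/K is totally (and wildly) ramified of degree p at v. -/

import Mathlib

open Polynomial

/-- `v` is a *normalized* discrete (additive) valuation on a field `K`:
it attains every integer value (i.e. `v : K^× → ℤ` is surjective). -/
def IsNormalizedVal {K : Type*} [Field K] (v : AddValuation K (WithTop ℤ)) : Prop :=
  ∀ n : ℤ, ∃ x : K, v x = (n : WithTop ℤ)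

/-- The valuation `w` on `L` extends the valuation `v` on `K` with ramification index `e`,
i.e. the restriction of `w` to `K^×` equals `e • v`. -/
def ExtendsWith {K L : Type*} [Field K] [Field L] [Algebra K L]
    (v : AddValuation K (WithTop ℤ)) (w : AddValuation L (WithTop ℤ)) (e : ℤ) : Prop :=
  ∀ (x : K) (n : ℤ), v x = (n : WithTop ℤ) →
    w (algebraMap K L x) = ((e * n : ℤ) : WithTop ℤ)

/-- `u ∈ L` lies in the integral closure in `L` of the valuation ring
`𝒪_K = {x : K | 0 ≤ v x}` : it is a root of a monic polynomial with coefficients in `𝒪_K`. -/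
def MemIntegralClosureOfVal {K L : Type*} [Field K] [Field L] [Algebra K L]
    (v : AddValuation K (WithTop ℤ)) (u : L) : Prop :=
  ∃ g : Polynomial K, g.Monic ∧ (∀ i, (0 : WithTop ℤ) ≤ v (g.coeff i)) ∧
    Polynomial.aeval u g = 0

/-- `w` is a normalized discrete valuation on `L` extending the valuation `v` of `K`
(with some positive ramification index). -/
def IsNormExtension {K L : Type*} [Field K] [Field L] [Algebra K L]
    (v : AddValuation K (WithTop ℤ)) (w : AddValuation L (WithTop ℤ)) : Prop :=
  IsNormalizedVal w ∧ ∃ e : ℤ, 0 < e ∧ ExtendsWith v w e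

/-- The residue field extension of `w` over `v` is trivial, i.e. the residue degree
`f(w|v)` equals `1`: every integer of `w` is congruent mod the maximal ideal to an
integer of `v`. -/
def ResidueDegreeOne {K L : Type*} [Field K] [Field L] [Algebra K L]
    (v : AddValuation K (WithTop ℤ)) (w : AddValuation L (WithTop ℤ)) : Prop :=
  ∀ y : L, 0 ≤ w y → ∃ x : K, 0 ≤ v x ∧ 0 < w (y - algebraMap K L x)

/-- The residue degree `f(w|v)` equals `d`: there is an integer `y` of `w` whose residue
powers `1, ȳ, …, ȳ^{d-1}` span the residue field of `w` over that of `v` (first clause)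
and are linearly independent over it (second clause). -/
def ResidueDegreeEq {K L : Type*} [Field K] [Field L] [Algebra K L]
    (v : AddValuation K (WithTop ℤ)) (w : AddValuation L (WithTop ℤ)) (d : ℕ) : Prop :=
  ∃ y : L, 0 ≤ w y ∧
    (∀ z : L, 0 ≤ w z → ∃ c : Fin d → K, (∀ i, 0 ≤ v (c i)) ∧
      0 < w (z - ∑ i : Fin d, algebraMap K L (c i) * y ^ (i : ℕ))) ∧
    (∀ c : Fin d → K, (∀ i, 0 ≤ v (c i)) →
      0 < w (∑ i : Fin d, algebraMap K L (c i) * y ^ (i : ℕ)) → ∀ i, 0 < v (c i))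

section

variable {K L Γ₀ Γ : Type*} [Field K] [Field L] [Algebra K L]
  [LinearOrderedCommGroupWithZero Γ₀] [LinearOrderedCommGroupWithZero Γ]

/-- Chevalley's theorem: every valuation extends, up to equivalence, to a field extension. -/
theorem exists_valuationSubring_isEquiv_comap (L : Type*) [Field L] [Algebra K L]
    (V : Valuation K Γ₀) :
    ∃ A : ValuationSubring L, V.IsEquiv (A.valuation.comap (algebraMap K L)) := by
  obtain ⟨A, hA, hloc⟩ := IsLocalRing.exists_factor_valuationRing
    ((algebraMap K L).comp V.valuationSubring.subtype)
  refine ⟨A, Valuation.isEquiv_of_val_le_one fun {x} => ?_⟩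
  rw [Valuation.comap_apply, ValuationSubring.valuation_le_one_iff]
  refine ⟨fun h => hA ⟨x, h⟩, fun h => ?_⟩
  by_contra hx
  rw [not_le] at hx
  have hx0 : x ≠ 0 := by rintro rfl; simp at hx
  have hinv : V x⁻¹ < 1 := by
    rw [map_inv₀]; exact inv_lt_one_of_one_lt₀ hx
  let r : V.valuationSubring := ⟨x⁻¹, hinv.le⟩
  have hr : IsUnit r := by
    apply hloc.map_nonunit
    refine IsUnit.of_mul_eq_one ⟨algebraMap K L x, h⟩ (Subtype.ext ?_)
    change algebraMap K L x⁻¹ * algebraMap K L x = 1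
    rw [← map_mul, inv_mul_cancel₀ hx0, map_one]
  obtain ⟨s, hs⟩ := isUnit_iff_exists_inv.mp hr
  have hs' : x⁻¹ * (s : K) = 1 := congrArg Subtype.val hs
  have hsx : (s : K) = x := by
    rwa [inv_mul_eq_iff_eq_mul₀ hx0, mul_one] at hs'
  have h1 : V (s : K) ≤ 1 := s.2
  rw [hsx] at h1
  exact absurd hx h1.not_gt

/-- A splitting field of `T ^ p - T - f` is spanned over `K` by the first `p` powers of a root. -/
theorem exists_eq_sum_root_pow {p : ℕ} (hp : p.Prime) [CharP K p] {f : K}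
    (hL : IsSplittingField K L (X ^ p - X - C f)) {y : L}
    (hy : y ^ p = y + algebraMap K L f) (z : L) :
    ∃ a : ℕ → K, z = ∑ i ∈ Finset.range p, algebraMap K L (a i) * y ^ i := by
  have := Fact.mk hp
  have : CharP L p := charP_of_injective_algebraMap (algebraMap K L).injective p
  have hdeg : (X + C f : K[X]).natDegree < p := by
    rw [natDegree_X_add_C]; exact hp.one_lt
  have hmon : (X ^ p - X - C f : K[X]).Monic := by
    rw [sub_sub]
    exact monic_X_pow_sub (degree_le_of_natDegree_le (by rw [natDegree_X_add_C]) |>.trans_lt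
      (by exact_mod_cast hp.one_lt))
  have hnat : (X ^ p - X - C f : K[X]).natDegree = p := by
    rw [sub_sub, natDegree_sub_eq_left_of_natDegree_lt, natDegree_X_pow]
    simpa using hp.one_lt
  have hroot : aeval y (X ^ p - X - C f : K[X]) = 0 := by
    simp [hy]
  have hadj : Algebra.adjoin K {y} = ⊤ := by
    rw [eq_top_iff, ← hL.adjoin_rootSet, Algebra.adjoin_le_iff]
    intro t ht
    have ht' := aeval_eq_zero_of_mem_rootSet ht
    have htp : (t - y) ^ p = t - y := by
      rw [sub_pow_char]
      simp only [map_sub, map_pow, aeval_X, aeval_C] at ht' hroot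
      linear_combination ht' - hroot
    rw [← Subfield.mem_bot_iff_pow_eq_self, ← ZMod.fieldRange_castHom_eq_bot p] at htp
    obtain ⟨c, hc⟩ := htp
    obtain ⟨m, rfl⟩ := ZMod.intCast_surjective c
    rw [map_intCast] at hc
    rw [← sub_add_cancel t y, ← hc]
    exact add_mem (intCast_mem _ m) (Algebra.self_mem_adjoin_singleton K y)
  have hz : z ∈ Algebra.adjoin K {y} := hadj ▸ Algebra.mem_top
  rw [Algebra.adjoin_singleton_eq_range_aeval] at hz
  obtain ⟨g, rfl⟩ := hz
  refine ⟨(g %ₘ (X ^ p - X - C f)).coeff, ?_⟩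
  have h1 : aeval y g = aeval y (g %ₘ (X ^ p - X - C f)) := by
    conv_lhs => rw [← modByMonic_add_div g (X ^ p - X - C f)]
    simp [-map_sub, hroot]
  have h2 : (g %ₘ (X ^ p - X - C f)).natDegree < p := by
    conv_rhs => rw [← hnat]
    exact natDegree_modByMonic_lt g hmon fun h => by
      rw [h, natDegree_one] at hnat
      exact hp.ne_zero hnat.symm
  change aeval y g = _
  rw [h1, aeval_eq_sum_range' h2]
  simp [Algebra.smul_def]

theorem Valuation.map_pow_eq_of_pow_eq_add (u : Valuation L Γ) {p : ℕ} {y b : L}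
    (hb : 1 < u b) (hp : 1 < p) (hy : y ^ p = y + b) : u y ^ p = u b := by
  have hyb : b = y ^ p - y := by rw [hy]; ring
  have h1 : 1 < u y := by
    by_contra! h
    refine hb.not_ge (hyb ▸ (u.map_sub _ _).trans (max_le ?_ h))
    rw [map_pow]
    exact pow_le_one₀ zero_le h
  rw [hyb, u.map_sub_eq_of_lt_left, map_pow]
  rw [map_pow]
  exact lt_self_pow₀ h1 hp

theorem Valuation.exists_dominant_index (V : Valuation K Γ₀) {p : ℕ} {f : K} (hf : f ≠ 0)
    (hdist : ∀ (i j : ℕ) (a b : K), i < p → j < p → a ≠ 0 → b ≠ 0 →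
      V (a ^ p * f ^ i) = V (b ^ p * f ^ j) → i = j)
    (a : ℕ → K) (ha : ∃ i < p, a i ≠ 0) :
    ∃ i < p, a i ≠ 0 ∧ ∀ j < p, j ≠ i → V (a j ^ p * f ^ j) < V (a i ^ p * f ^ i) := by
  obtain ⟨k, hk, hak⟩ := ha
  have hp0 : p ≠ 0 := by omega
  obtain ⟨i, hi, hmax⟩ := (Finset.range p).exists_max_image (fun j => V (a j ^ p * f ^ j))
    ⟨k, Finset.mem_range.2 hk⟩
  simp only [Finset.mem_range] at hi hmax
  have hai : a i ≠ 0 := by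
    intro h
    have := hmax k hk
    rw [h, zero_pow hp0, zero_mul, map_zero, le_zero_iff, V.zero_iff] at this
    exact mul_ne_zero (pow_ne_zero _ hak) (pow_ne_zero _ hf) this
  refine ⟨i, hi, hai, fun j hj hji => lt_of_le_of_ne (hmax j hj) fun h => ?_⟩
  by_cases haj : a j = 0
  · rw [haj, zero_pow hp0, zero_mul, map_zero, eq_comm, V.zero_iff] at h
    exact mul_ne_zero (pow_ne_zero _ hai) (pow_ne_zero _ hf) h
  · exact hji (hdist j i _ _ hj hi haj hai h)

/-- If one term of the expansion `∑ a j * y ^ j` strictly dominates, as measured on `K` through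
`p`-th powers, then the remainder of the sum is strictly smaller for every extension of `V`. -/
theorem Valuation.IsEquiv.map_sum_sub_lt {V : Valuation K Γ₀} {u : Valuation L Γ}
    (hu : V.IsEquiv (u.comap (algebraMap K L))) {p : ℕ} (hp : 1 < p) {f : K} (hf : 1 < V f)
    {y : L} (hy : y ^ p = y + algebraMap K L f) {a : ℕ → K} {i : ℕ} (hi : i < p)
    (hlt : ∀ j < p, j ≠ i → V (a j ^ p * f ^ j) < V (a i ^ p * f ^ i)) (hai : a i ≠ 0) :
    u (∑ j ∈ Finset.range p, algebraMap K L (a j) * y ^ j - algebraMap K L (a i) * y ^ i) <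
      u (algebraMap K L (a i) * y ^ i) := by
  have hf' : 1 < u (algebraMap K L f) := by
    have := (hu.lt_iff_lt (x := 1) (y := f)).1 (by simpa using hf)
    simpa using this
  have hyp := u.map_pow_eq_of_pow_eq_add hf' hp hy
  have key (j : ℕ) : u (algebraMap K L (a j) * y ^ j) ^ p =
      u.comap (algebraMap K L) (a j ^ p * f ^ j) := by
    simp only [map_mul, map_pow, mul_pow, Valuation.comap_apply, ← hyp]
    rw [pow_right_comm]
  have hf0 : f ≠ 0 := by rintro rfl; simp at hf
  rw [← Finset.add_sum_erase _ _ (Finset.mem_range.2 hi), add_sub_cancel_left]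
  refine u.map_sum_lt ?_ fun j hj => ?_
  · rw [← pow_ne_zero_iff (n := p) (by omega), key, Valuation.ne_zero_iff]
    exact mul_ne_zero (pow_ne_zero _ hai) (pow_ne_zero _ hf0)
  · rw [Finset.mem_erase, Finset.mem_range] at hj
    refine lt_of_pow_lt_pow_left₀ p zero_le ?_
    rw [key, key, ← hu.lt_iff_lt]
    exact hlt j hj.2 hj.1

/-- Up to `p`-th powers, the value of `z` under every extension of `V` is the value of a single
element of `K`, the same one for all extensions. -/
theorem Valuation.IsEquiv.map_sum_pow {V : Valuation K Γ₀} {u : Valuation L Γ}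
    (hu : V.IsEquiv (u.comap (algebraMap K L))) {p : ℕ} (hp : 1 < p) {f : K} (hf : 1 < V f)
    {y : L} (hy : y ^ p = y + algebraMap K L f) {a : ℕ → K} {i : ℕ} (hi : i < p)
    (hlt : ∀ j < p, j ≠ i → V (a j ^ p * f ^ j) < V (a i ^ p * f ^ i)) (hai : a i ≠ 0) :
    u ((∑ j ∈ Finset.range p, algebraMap K L (a j) * y ^ j) ^ p) =
      u (algebraMap K L (a i ^ p * f ^ i)) := by
  have hf' : 1 < u (algebraMap K L f) := by
    have := (hu.lt_iff_lt (x := 1) (y := f)).1 (by simpa using hf)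
    simpa using this
  rw [map_pow, u.map_eq_of_sub_lt (hu.map_sum_sub_lt hp hf hy hi hlt hai)]
  simp only [map_mul, map_pow, mul_pow, ← u.map_pow_eq_of_pow_eq_add hf' hp hy]
  rw [pow_right_comm]

/-- If the `p`-th powers of `L` take under `u` only values of elements of `K`, then `z ↦ V c`,
where `u (z ^ p) = u c`, is a valuation on `L`. -/
theorem Valuation.IsEquiv.exists_valuation_of_pow {V : Valuation K Γ₀} {u : Valuation L Γ}
    (hu : V.IsEquiv (u.comap (algebraMap K L))) {p : ℕ}
    (h : ∀ z : L, ∃ c : K, u (z ^ p) = u (algebraMap K L c)) (hp : p ≠ 0) :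
    ∃ W : Valuation L Γ₀, ∀ (z : L) (c : K), u (z ^ p) = u (algebraMap K L c) → W z = V c := by
  choose c hc using h
  have huniq (z : L) (d : K) (hd : u (z ^ p) = u (algebraMap K L d)) : V (c z) = V d :=
    hu.eq_iff.2 ((hc z).symm.trans hd)
  have hle (x y : L) (hxy : u x ≤ u y) : V (c x) ≤ V (c y) := by
    refine (hu _ _).2 ?_
    rw [Valuation.comap_apply, Valuation.comap_apply, ← hc, ← hc, map_pow, map_pow]
    exact pow_le_pow_left₀ zero_le hxy p
  refine ⟨⟨⟨⟨fun z => V (c z), ?_⟩, ?_, fun x y => ?_⟩, fun x y => ?_⟩, huniq⟩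
  · rw [← map_zero V]
    exact huniq _ _ (by simp [hp])
  · rw [← map_one V]
    exact huniq _ _ (by simp)
  · change V (c (x * y)) = V (c x) * V (c y)
    rw [← map_mul]
    exact huniq _ _ (by rw [mul_pow, map_mul, map_mul, map_mul, hc, hc])
  · change V (c (x + y)) ≤ max (V (c x)) (V (c y))
    rcases le_max_iff.1 (u.map_add x y) with h | h
    · exact (hle _ _ h).trans (le_max_left _ _)
    · exact (hle _ _ h).trans (le_max_right _ _)

theorem AddValuation.exists_int_eq (v : AddValuation K (WithTop ℤ)) {x : K} (hx : x ≠ 0) :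
    ∃ k : ℤ, v x = (k : WithTop ℤ) := by
  obtain ⟨k, hk⟩ := WithTop.ne_top_iff_exists.1 (v.ne_top_iff.2 hx)
  exact ⟨k, hk.symm⟩

theorem ExtendsWith.isEquiv_comap {v : AddValuation K (WithTop ℤ)}
    {w : AddValuation L (WithTop ℤ)} {e : ℤ} (h : ExtendsWith v w e) (he : 0 < e) :
    (AddValuation.toValuation v).IsEquiv
      ((AddValuation.toValuation w).comap (algebraMap K L)) := by
  refine Valuation.isEquiv_of_val_le_one fun {x} => ?_
  change (0 : WithTop ℤ) ≤ v x ↔ (0 : WithTop ℤ) ≤ w (algebraMap K L x)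
  by_cases hx : x = 0
  · simp [hx]
  · obtain ⟨k, hk⟩ := v.exists_int_eq hx
    rw [h x k hk, hk]
    norm_cast
    exact (mul_nonneg_iff_of_pos_left he).symm

theorem AddValuation.map_pow_mul_pow_of_eq (v : AddValuation K (WithTop ℤ)) {a f : K} {k n : ℤ}
    (ha : v a = (k : WithTop ℤ)) (hf : v f = (n : WithTop ℤ)) (p i : ℕ) :
    v (a ^ p * f ^ i) = ((p * k + i * n : ℤ) : WithTop ℤ) := by
  rw [v.map_mul, v.map_pow, v.map_pow, ha, hf]
  simp only [← WithTop.coe_nsmul, ← WithTop.coe_add, nsmul_eq_mul]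

theorem AddValuation.index_eq_of_map_pow_mul_pow_eq (v : AddValuation K (WithTop ℤ)) {p : ℕ}
    (hp : p.Prime) {f : K} {n : ℤ} (hf : v f = (n : WithTop ℤ)) (hpn : ¬ (p : ℤ) ∣ n)
    {i j : ℕ} {a b : K} (hi : i < p) (hj : j < p) (ha : a ≠ 0) (hb : b ≠ 0)
    (h : v (a ^ p * f ^ i) = v (b ^ p * f ^ j)) : i = j := by
  obtain ⟨k, hk⟩ := v.exists_int_eq ha
  obtain ⟨l, hl⟩ := v.exists_int_eq hb
  rw [v.map_pow_mul_pow_of_eq hk hf, v.map_pow_mul_pow_of_eq hl hf, WithTop.coe_inj] at h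
  have hdvd : (p : ℤ) ∣ (i - j) * n := ⟨l - k, by linear_combination h⟩
  have hij := ((Nat.prime_iff_prime_int.1 hp).dvd_or_dvd hdvd).resolve_right hpn
  have := Int.eq_zero_of_abs_lt_dvd hij (by rw [abs_lt]; omega)
  omega

/-- Two normalized extensions that agree, up to `p`-th powers, with a common element of `K` on
each element of `L` coincide. -/
theorem ExtendsWith.eq_of_isNormalizedVal {v : AddValuation K (WithTop ℤ)}
    {w w' : AddValuation L (WithTop ℤ)} {e : ℤ} {p : ℕ} (hp : 0 < p) (h : ExtendsWith v w p)
    (h' : ExtendsWith v w' e) (he : 0 < e) (hw : IsNormalizedVal w) (hw' : IsNormalizedVal w')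
    (hc : ∀ z : L, ∃ c : K, w (z ^ p) = w (algebraMap K L c) ∧
      w' (z ^ p) = w' (algebraMap K L c)) : w' = w := by
  have key (z : L) (k l : ℤ) (hk : w z = (k : WithTop ℤ)) (hl : w' z = (l : WithTop ℤ)) :
      p * l = e * k := by
    obtain ⟨c, hc, hc'⟩ := hc z
    have hc0 : c ≠ 0 := by
      rintro rfl
      rw [w.map_pow, hk, map_zero, w.map_zero, ← WithTop.coe_nsmul] at hc
      exact WithTop.coe_ne_top hc
    obtain ⟨m, hm⟩ := v.exists_int_eq hc0
    rw [w.map_pow, hk, h c m hm, ← WithTop.coe_nsmul, WithTop.coe_inj, nsmul_eq_mul] at hc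
    rw [w'.map_pow, hl, h' c m hm, ← WithTop.coe_nsmul, WithTop.coe_inj, nsmul_eq_mul] at hc'
    have hp' : (p : ℤ) ≠ 0 := by exact_mod_cast hp.ne'
    rw [hc', mul_left_cancel₀ hp' hc]
  have hne {u : AddValuation L (WithTop ℤ)} {z : L} {k : ℤ} (hz : u z = (k : WithTop ℤ)) :
      z ≠ 0 := u.ne_top_iff.1 (hz ▸ WithTop.coe_ne_top)
  have hep : e = p := by
    obtain ⟨x, hx⟩ := hw 1
    obtain ⟨l, hl⟩ := w'.exists_int_eq (hne hx)
    obtain ⟨x', hx'⟩ := hw' 1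
    obtain ⟨k, hk⟩ := w.exists_int_eq (hne hx')
    exact Int.dvd_antisymm he.le (by positivity) ⟨k, by linear_combination key x' k 1 hk hx'⟩
      ⟨l, by linear_combination - key x 1 l hx hl⟩
  refine AddValuation.ext fun z => ?_
  by_cases hz : z = 0
  · simp [hz]
  · obtain ⟨k, hk⟩ := w.exists_int_eq hz
    obtain ⟨l, hl⟩ := w'.exists_int_eq hz
    have := key z k l hk hl
    rw [hep] at this
    rw [hk, hl, mul_left_cancel₀ (by exact_mod_cast hp.ne') this]

/-- A valuation with ramification index `p` which takes a value prime to `p` is normalized. -/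
theorem ExtendsWith.isNormalizedVal {v : AddValuation K (WithTop ℤ)}
    {w : AddValuation L (WithTop ℤ)} {p : ℕ} (h : ExtendsWith v w p) (hv : IsNormalizedVal v)
    (hp : p.Prime) {y : L} {n : ℤ} (hy : w y = (n : WithTop ℤ)) (hpn : ¬ (p : ℤ) ∣ n) :
    IsNormalizedVal w := by
  intro m
  have hp0 : (p : ℤ) ≠ 0 := by exact_mod_cast hp.ne_zero
  obtain ⟨s, t, hst⟩ := (Nat.prime_iff_prime_int.1 hp).coprime_iff_not_dvd.2 hpn
  obtain ⟨k, hk⟩ := Int.eq_ofNat_of_zero_le (Int.emod_nonneg (m * t) hp0)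
  obtain ⟨b, hb⟩ := hv (m * t / p * n + m * s)
  refine ⟨algebraMap K L b * y ^ k, ?_⟩
  rw [w.map_mul, w.map_pow, h b _ hb, hy, ← WithTop.coe_nsmul, ← WithTop.coe_add,
    WithTop.coe_inj, nsmul_eq_mul, ← hk]
  have := Int.emod_add_mul_ediv (m * t) p
  linear_combination m * hst + n * this

end

/-- Let `K` have characteristic `p > 0` with normalized discrete valuation
`v`.  Let `f ∈ K` with `v(f) < 0` and `p ∤ v(f)`, and let `L = K_{℘,f}` be the splitting
field of `T^p - T - f` over `K`.  Then there is a unique (normalized) extension `v_L` of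
`v` to `L`, and it satisfies `e(v_L|v) = p` and `f(v_L|v) = 1`: `L/K` is totally (and
wildly) ramified of degree `p` at `v`. -/
theorem statement_10 (p : ℕ) (hp : p.Prime) (K : Type) [Field K] [CharP K p]
    (v : AddValuation K (WithTop ℤ)) (hv : IsNormalizedVal v)
    (f : K) (n : ℤ) (hfn : v f = (n : WithTop ℤ)) (hneg : n < 0) (hpn : ¬ (p : ℤ) ∣ n)
    (L : Type) [Field L] [Algebra K L]
    (hL : Polynomial.IsSplittingField K L (Polynomial.X ^ p - Polynomial.X - Polynomial.C f)) :
    ∃ w : AddValuation L (WithTop ℤ), IsNormExtension v w ∧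
      (∀ w' : AddValuation L (WithTop ℤ), IsNormExtension v w' → w' = w) ∧
      ExtendsWith v w (p : ℤ) ∧ ResidueDegreeOne v w := by
  have hp1 := hp.one_lt
  set V := AddValuation.toValuation v
  have hVf : 1 < V f := by
    change v f < (0 : WithTop ℤ)
    rw [hfn]
    exact_mod_cast hneg
  have hf0 : f ≠ 0 := by rintro rfl; simp at hVf
  obtain ⟨y, hy⟩ : ∃ y : L, y ^ p = y + algebraMap K L f := by
    obtain ⟨y, hy⟩ := hL.splits.exists_eval_eq_zero (by
      rw [degree_map, sub_sub, degree_sub_eq_left_of_degree_lt] <;>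
        simp [degree_X_add_C, hp1, hp.ne_zero])
    refine ⟨y, ?_⟩
    simp only [Polynomial.map_sub, Polynomial.map_pow, map_X, map_C, eval_sub, eval_pow, eval_X,
      eval_C] at hy
    linear_combination hy
  have hexp (z : L) (hz : z ≠ 0) : ∃ (a : ℕ → K) (i : ℕ), i < p ∧ a i ≠ 0 ∧
      z = ∑ j ∈ Finset.range p, algebraMap K L (a j) * y ^ j ∧
      ∀ j < p, j ≠ i → V (a j ^ p * f ^ j) < V (a i ^ p * f ^ i) := by
    obtain ⟨a, ha⟩ := exists_eq_sum_root_pow hp hL hy z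
    have ha' : ∃ i < p, a i ≠ 0 := by
      by_contra! h
      refine hz (ha.trans (Finset.sum_eq_zero fun j hj => ?_))
      rw [h j (Finset.mem_range.1 hj), map_zero, zero_mul]
    obtain ⟨i, hi, hai, hlt⟩ := V.exists_dominant_index hf0
      (fun i j a b hi hj ha hb h => v.index_eq_of_map_pow_mul_pow_eq hp hfn hpn hi hj ha hb h) a ha'
    exact ⟨a, i, hi, hai, ha, hlt⟩
  have hpow (z : L) : ∃ c : K, ∀ (Γ : Type) [LinearOrderedCommGroupWithZero Γ]
      (u : Valuation L Γ), V.IsEquiv (u.comap (algebraMap K L)) →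
        u (z ^ p) = u (algebraMap K L c) := by
    by_cases hz : z = 0
    · exact ⟨0, fun Γ _ u _ => by simp [hz, hp.ne_zero]⟩
    · obtain ⟨a, i, hi, hai, hza, hlt⟩ := hexp z hz
      exact ⟨a i ^ p * f ^ i, fun Γ _ u hu => hza ▸ hu.map_sum_pow hp1 hVf hy hi hlt hai⟩
  obtain ⟨A, hA⟩ := exists_valuationSubring_isEquiv_comap L V
  obtain ⟨W, hW⟩ := hA.exists_valuation_of_pow
    (fun z => (hpow z).imp fun c hc => hc _ _ hA) hp.ne_zero
  let w : AddValuation L (WithTop ℤ) := AddValuation.ofValuation W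
  have hwv (z : L) (c : K) (h : A.valuation (z ^ p) = A.valuation (algebraMap K L c)) :
      w z = v c := hW z c h
  have hext : ExtendsWith v w p := by
    intro x k hk
    rw [hwv (algebraMap K L x) (x ^ p) (by rw [map_pow (algebraMap K L)]), v.map_pow, hk,
      ← WithTop.coe_nsmul, nsmul_eq_mul]
  have hAf : 1 < A.valuation (algebraMap K L f) := hA.one_lt_iff_one_lt.1 hVf
  have hwy : w y = (n : WithTop ℤ) := by
    rw [← hfn]
    exact hwv y f (by rw [map_pow, A.valuation.map_pow_eq_of_pow_eq_add hAf hp1 hy])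
  have hnorm : IsNormalizedVal w := hext.isNormalizedVal hv hp hwy hpn
  have hp0 : (0 : ℤ) < p := by exact_mod_cast hp.pos
  have hequiv := hext.isEquiv_comap hp0
  refine ⟨w, ⟨hnorm, p, hp0, hext⟩, ?_, hext, ?_⟩
  · rintro w' ⟨hnorm', e, he, hext'⟩
    refine hext.eq_of_isNormalizedVal hp.pos hext' he hnorm hnorm' fun z => ?_
    obtain ⟨c, hc⟩ := hpow z
    exact ⟨c, hc _ (AddValuation.toValuation w) hequiv,
      hc _ (AddValuation.toValuation w') (hext'.isEquiv_comap he)⟩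
  · intro z hz
    rcases hz.lt_or_eq with hz | hz
    · exact ⟨0, by simp, by simpa using hz⟩
    have hz0 : z ≠ 0 := by
      rintro rfl
      simp at hz
    obtain ⟨a, i, hi, hai, hza, hlt⟩ := hexp z hz0
    have hrem : w (algebraMap K L (a i) * y ^ i) < w (z - algebraMap K L (a i) * y ^ i) := by
      rw [hza]
      exact Valuation.IsEquiv.map_sum_sub_lt hequiv hp1 hVf hy hi hlt hai
    have hwz : w (algebraMap K L (a i) * y ^ i) = 0 := by
      rw [hz]
      exact (w.map_eq_of_lt_sub hrem).symm
    rw [hwz] at hrem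
    obtain ⟨k, hk⟩ := v.exists_int_eq hai
    rw [w.map_mul, w.map_pow, hext _ k hk, hwy, ← WithTop.coe_nsmul, ← WithTop.coe_add,
      nsmul_eq_mul, WithTop.coe_eq_zero] at hwz
    have hdvd : (p : ℤ) ∣ i * n := ⟨-k, by linear_combination hwz⟩
    have hpi := ((Nat.prime_iff_prime_int.1 hp).dvd_or_dvd hdvd).resolve_right hpn
    obtain rfl : i = 0 := Nat.eq_zero_of_dvd_of_lt (Int.natCast_dvd_natCast.1 hpi) hi
    have hk0 : k = 0 := by
      simpa [hp.ne_zero] using hwz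
    refine ⟨a 0, by rw [hk, hk0]; rfl, by simpa using hrem⟩
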